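/- Suppose there is an index i ∈ {1,…,r} such that t ≡ e_i (mod p) in ℤ_p and such that the residue class of a_i modulo p is not a square in ℤ/pℤ. Then the p-adic valuation v_p(v) is an even integer. -/

import Mathlib

open scoped BigOperators

/-- The kernel of reduction modulo `p` consists of the multiples of `p`. -/
lemma PadicInt.toZMod_eq_zero_iff_dvd {p : ℕ} [Fact p.Prime] (x : ℤ_[p]) :
    PadicInt.toZMod x = 0 ↔ (p : ℤ_[p]) ∣ x := by
  rw [← RingHom.mem_ker, PadicInt.ker_toZMod, PadicInt.maximalIdeal_eq_span_p,
    Ideal.mem_span_singleton]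

lemma PadicInt.valuation_eq_zero_of_not_dvd {p : ℕ} [Fact p.Prime] {x : ℤ_[p]}
    (hx : ¬ (p : ℤ_[p]) ∣ x) : x.valuation = 0 := by
  by_contra h
  have hx0 : x ≠ 0 := by
    rintro rfl
    exact hx (dvd_zero _)
  refine hx ((dvd_pow_self _ h).trans ?_)
  rw [← Ideal.mem_span_singleton]
  exact (PadicInt.mem_span_pow_iff_le_valuation x hx0 _).2 le_rfl

/-- Nonzero values of the norm form `x² - a y²` have even valuation when `a` is not a square
modulo `p`. -/
lemma PadicInt.even_valuation_sq_sub_mul_sq {p : ℕ} [hp : Fact p.Prime] {a : ℤ}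
    (ha : ¬ IsSquare (a : ZMod p)) {x y : ℤ_[p]} (h : x ^ 2 - (a : ℤ_[p]) * y ^ 2 ≠ 0) :
    Even (x ^ 2 - (a : ℤ_[p]) * y ^ 2).valuation := by
  induction hn : (x ^ 2 - (a : ℤ_[p]) * y ^ 2).valuation using Nat.strong_induction_on
    generalizing x y with
  | _ n ih =>
    by_cases hd : (p : ℤ_[p]) ∣ x ^ 2 - (a : ℤ_[p]) * y ^ 2
    · have hz := (PadicInt.toZMod_eq_zero_iff_dvd _).2 hd
      simp only [map_sub, map_mul, map_pow, map_intCast, sub_eq_zero] at hz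
      have hy : PadicInt.toZMod y = 0 := by
        by_contra hy
        refine ha ⟨PadicInt.toZMod x / PadicInt.toZMod y, ?_⟩
        field_simp
        exact hz.symm
      have hx : PadicInt.toZMod x = 0 := by simpa [hy] using hz
      obtain ⟨x', rfl⟩ := (PadicInt.toZMod_eq_zero_iff_dvd _).1 hx
      obtain ⟨y', rfl⟩ := (PadicInt.toZMod_eq_zero_iff_dvd _).1 hy
      have key : ((p : ℤ_[p]) * x') ^ 2 - (a : ℤ_[p]) * (p * y') ^ 2
          = p ^ 2 * (x' ^ 2 - (a : ℤ_[p]) * y' ^ 2) := by ring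
      rw [key] at h hn
      have h' := right_ne_zero_of_mul h
      rw [PadicInt.valuation_p_pow_mul _ _ h'] at hn
      rw [← hn]
      exact even_two.add (ih _ (by lia) h' rfl)
    · rw [← hn, PadicInt.valuation_eq_zero_of_not_dvd hd]
      exact Even.zero

lemma PadicInt.not_dvd_intCast {p : ℕ} [Fact p.Prime] {n : ℤ} (hn : ¬ (p : ℤ) ∣ n) :
    ¬ (p : ℤ_[p]) ∣ (n : ℤ_[p]) := by
  rwa [← PadicInt.toZMod_eq_zero_iff_dvd, map_intCast, ZMod.intCast_zmod_eq_zero_iff_dvd]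

/-- Let `p` be an odd prime, `a₁,…,a_r` integers prime to `p` with product `a₀`,
`e₁,…,e_r` integers pairwise incongruent mod `p`, and `λ₁,…,λ_r` integers prime to `p`.
Suppose `t, v ∈ ℤ_p` with `v ≠ 0` are such that `v = x₀² − a₀ y₀²` for some
`x₀, y₀ ∈ ℤ_p` and, for each `j`, `v(t − e_j) = λ_j (x_j² − a_j y_j²) ≠ 0` for some
`x_j, y_j ∈ ℤ_p`. If there is an index `i` with `t ≡ e_i (mod p)` and `a_i` not a
square mod `p`, then the `p`-adic valuation of `v` is even. -/
theorem padicInt_valuation_even (p : ℕ) [hp : Fact p.Prime] (hodd : p ≠ 2)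
    (r : ℕ) (hr : 1 ≤ r)
    (a : Fin r → ℤ) (ha : ∀ j, ¬ (p : ℤ) ∣ a j)
    (e : Fin r → ℤ) (he : ∀ j k, j ≠ k → ¬ (p : ℤ) ∣ (e j - e k))
    (lam : Fin r → ℤ) (hlam : ∀ j, ¬ (p : ℤ) ∣ lam j)
    (t v : ℤ_[p]) (hv : v ≠ 0)
    (h₀ : ∃ x₀ y₀ : ℤ_[p], v = x₀ ^ 2 - ((∏ j, a j : ℤ) : ℤ_[p]) * y₀ ^ 2)
    (hj : ∀ j : Fin r, ∃ x y : ℤ_[p],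
      v * (t - (e j : ℤ_[p])) = (lam j : ℤ_[p]) * (x ^ 2 - (a j : ℤ_[p]) * y ^ 2) ∧
        v * (t - (e j : ℤ_[p])) ≠ 0)
    (i : Fin r) (hti : (p : ℤ_[p]) ∣ (t - (e i : ℤ_[p])))
    (hai : ¬ IsSquare ((a i : ZMod p))) :
    Even (PadicInt.valuation v) := by
  by_cases hsq : ∀ j, j ≠ i → IsSquare (a j : ZMod p)
  · obtain ⟨x, y, rfl⟩ := h₀
    refine PadicInt.even_valuation_sq_sub_mul_sq (fun hs => hai ?_) hv
    have hprod : IsSquare (∏ j ∈ Finset.univ.erase i, (a j : ZMod p)) :=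
      Finset.isSquare_prod _ fun j hj => hsq j (Finset.ne_of_mem_erase hj)
    have hne : ∏ j ∈ Finset.univ.erase i, (a j : ZMod p) ≠ 0 :=
      Finset.prod_ne_zero_iff.2 fun j _ => by
        rw [Ne, ZMod.intCast_zmod_eq_zero_iff_dvd]
        exact ha j
    rw [Int.cast_prod, ← Finset.mul_prod_erase _ _ (Finset.mem_univ i)] at hs
    simpa [hne] using hs.div hprod
  · push Not at hsq
    obtain ⟨j, hji, hns⟩ := hsq
    obtain ⟨x, y, hxy, hne⟩ := hj j
    have hlamj := PadicInt.not_dvd_intCast (hlam j)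
    have htj : ¬ (p : ℤ_[p]) ∣ t - (e j : ℤ_[p]) := fun h => by
      refine PadicInt.not_dvd_intCast (he j i hji) ?_
      simpa using dvd_sub hti h
    have hne' := hne
    rw [hxy] at hne'
    have hval := congrArg PadicInt.valuation hxy
    rw [PadicInt.valuation_mul hv (right_ne_zero_of_mul hne),
      PadicInt.valuation_mul (left_ne_zero_of_mul hne') (right_ne_zero_of_mul hne'),
      PadicInt.valuation_eq_zero_of_not_dvd htj, PadicInt.valuation_eq_zero_of_not_dvd hlamj,
      add_zero, zero_add] at hval
    rw [hval]
    exact PadicInt.even_valuation_sq_sub_mul_sq hns (right_ne_zero_of_mul hne')
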